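/- arXiv:1601.01212 — 4 statements merged into one kernel-verified Lean document; each statement's English description precedes it below -/
import Mathlib

section
/- For an N-qubit system and pairwise distinct sites i, j, k, the commutator identity i[H_{ij}, H_{ijk}] = 4(H_{ik} − H_{jk}) holds, where H_{ij} = σ^(i)·σ^(j) and H_{ijk} = σ^(i)·(σ^(j)×σ^(k)). -/
/- N-qubit operators: matrices indexed by `Fin N → Fin 2`, identified with
Kronecker products. Sites are labeled `1, …, N`. -/

noncomputable def pauli : Fin 3 → Matrix (Fin 2) (Fin 2) ℂ :=
  ![!![0, 1; 1, 0], !![0, -Complex.I; Complex.I, 0], !![1, 0; 0, -1]]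

/-- The Pauli matrix `σ_a` acting on qubit `n` (sites labeled `1, …, N`) and as the
identity elsewhere. -/
noncomputable def pauliAt (N n : ℕ) (a : Fin 3) :
    Matrix (Fin N → Fin 2) (Fin N → Fin 2) ℂ :=
  Matrix.of fun f g =>
    ∏ m : Fin N, if (m : ℕ) + 1 = n then pauli a (f m) (g m)
      else (if f m = g m then 1 else 0)

/-- `H_{mn} = σ^(m) · σ^(n)`. -/
noncomputable def twoBody (N m n : ℕ) : Matrix (Fin N → Fin 2) (Fin N → Fin 2) ℂ :=
  ∑ a : Fin 3, pauliAt N m a * pauliAt N n a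

/-- Levi-Civita symbol on `Fin 3`. -/
def eps (a b c : Fin 3) : ℂ :=
  if (a, b, c) = (0, 1, 2) ∨ (a, b, c) = (1, 2, 0) ∨ (a, b, c) = (2, 0, 1) then 1
  else if (a, b, c) = (2, 1, 0) ∨ (a, b, c) = (1, 0, 2) ∨ (a, b, c) = (0, 2, 1) then -1
  else 0

/-- `H_{ijk} = σ^(i) · (σ^(j) × σ^(k))`. -/
noncomputable def threeBody (N i j k : ℕ) : Matrix (Fin N → Fin 2) (Fin N → Fin 2) ℂ :=
  ∑ a : Fin 3, ∑ b : Fin 3, ∑ c : Fin 3,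
    eps a b c • (pauliAt N i a * pauliAt N j b * pauliAt N k c)

/-- The Kronecker product of a family of one-qubit operators. -/
def kron {N : ℕ} (F : Fin N → Matrix (Fin 2) (Fin 2) ℂ) :
    Matrix (Fin N → Fin 2) (Fin N → Fin 2) ℂ :=
  Matrix.of fun f g => ∏ m, F m (f m) (g m)

theorem kron_mul {N : ℕ} (F G : Fin N → Matrix (Fin 2) (Fin 2) ℂ) :
    kron F * kron G = kron (F * G) := by
  ext f g
  simp only [kron, Matrix.mul_apply, Matrix.of_apply, Pi.mul_apply, Finset.prod_univ_sum,
    Fintype.piFinset_univ, Finset.prod_mul_distrib]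

theorem kron_smul {N : ℕ} (c : Fin N → ℂ) (F : Fin N → Matrix (Fin 2) (Fin 2) ℂ) :
    kron (fun m => c m • F m) = (∏ m, c m) • kron F := by
  ext f g
  simp [kron, Finset.prod_mul_distrib]

theorem kron_one (N : ℕ) : kron (1 : Fin N → Matrix (Fin 2) (Fin 2) ℂ) = 1 := by
  ext f g
  simp [kron, Matrix.one_apply, Finset.prod_ite_zero, funext_iff]

theorem pauliAt_eq_kron (N n : ℕ) (a : Fin 3) :
    pauliAt N n a = kron fun m => if (m : ℕ) + 1 = n then pauli a else 1 := by
  ext f g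
  simp only [pauliAt, kron, Matrix.of_apply]
  refine Finset.prod_congr rfl fun m _ => ?_
  split_ifs <;> simp_all [Matrix.one_apply]

theorem pauliAt_comm {N m n : ℕ} (h : m ≠ n) (a b : Fin 3) :
    pauliAt N m a * pauliAt N n b = pauliAt N n b * pauliAt N m a := by
  simp only [pauliAt_eq_kron, kron_mul]
  congr 1
  funext p
  simp only [Pi.mul_apply]
  split_ifs <;> first | omega | simp

theorem pauliAt_mul_self {N n : ℕ} (a : Fin 3) : pauliAt N n a * pauliAt N n a = 1 := by
  rw [← kron_one, pauliAt_eq_kron, kron_mul]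
  congr 1
  funext p
  have h : pauli a * pauli a = 1 := by
    fin_cases a <;> ext i j <;> fin_cases i <;> fin_cases j <;> simp [pauli]
  simp only [Pi.mul_apply, Pi.one_apply]
  split_ifs <;> simp [h]

theorem pauliAt_mul_eq_smul {N n : ℕ} (hn : 1 ≤ n) (hnN : n ≤ N) {a b d : Fin 3} {c : ℂ}
    (h : pauli a * pauli b = c • pauli d) :
    pauliAt N n a * pauliAt N n b = c • pauliAt N n d := by
  have hc : ∏ m : Fin N, (if (m : ℕ) + 1 = n then c else 1) = c := by
    rw [Finset.prod_eq_single (⟨n - 1, by omega⟩ : Fin N)]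
    · simp [Nat.sub_add_cancel hn]
    · intro m _ hm
      rw [if_neg]
      rintro rfl
      exact hm (by ext; simp)
    · simp
  conv_rhs => rw [← hc]
  rw [pauliAt_eq_kron, pauliAt_eq_kron, pauliAt_eq_kron, kron_mul, ← kron_smul]
  congr 1
  funext p
  simp only [Pi.mul_apply]
  split_ifs <;> simp [h]

/-- The multiplication table of the Pauli matrices. -/
structure IsPauliTriple {R : Type*} [Ring R] [Algebra ℂ R] (s : Fin 3 → R) : Prop where
  sq (a : Fin 3) : s a * s a = 1
  xy : s 0 * s 1 = Complex.I • s 2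
  yx : s 1 * s 0 = (-Complex.I) • s 2
  yz : s 1 * s 2 = Complex.I • s 0
  zy : s 2 * s 1 = (-Complex.I) • s 0
  zx : s 2 * s 0 = Complex.I • s 1
  xz : s 0 * s 2 = (-Complex.I) • s 1

theorem isPauliTriple_pauliAt {N n : ℕ} (hn : 1 ≤ n) (hnN : n ≤ N) :
    IsPauliTriple (pauliAt N n) where
  sq := pauliAt_mul_self
  xy := pauliAt_mul_eq_smul hn hnN <| by
    ext i j; fin_cases i <;> fin_cases j <;> simp [pauli]
  yx := pauliAt_mul_eq_smul hn hnN <| by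
    ext i j; fin_cases i <;> fin_cases j <;> simp [pauli]
  yz := pauliAt_mul_eq_smul hn hnN <| by
    ext i j; fin_cases i <;> fin_cases j <;> simp [pauli]
  zy := pauliAt_mul_eq_smul hn hnN <| by
    ext i j; fin_cases i <;> fin_cases j <;> simp [pauli]
  zx := pauliAt_mul_eq_smul hn hnN <| by
    ext i j; fin_cases i <;> fin_cases j <;> simp [pauli]
  xz := pauliAt_mul_eq_smul hn hnN <| by
    ext i j; fin_cases i <;> fin_cases j <;> simp [pauli]

/-- For commuting Pauli triples, `i[s · t, (s × t)_a] = 4(s_a − t_a)`. -/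
theorem IsPauliTriple.comm_dot_cross {R : Type*} [Ring R] [Algebra ℂ R] {s t : Fin 3 → R}
    (hs : IsPauliTriple s) (ht : IsPauliTriple t) (hst : ∀ a b, t b * s a = s a * t b)
    (a : Fin 3) :
    Complex.I • ((∑ b, s b * t b) * (∑ b, ∑ c, eps b c a • (s b * t c))
      - (∑ b, ∑ c, eps b c a • (s b * t c)) * (∑ b, s b * t b)) = (4 : ℂ) • (s a - t a) := by
  have key (a b c d : Fin 3) : s a * t b * (s c * t d) = (s a * s c) * (t b * t d) := by
    rw [mul_assoc, ← mul_assoc (t b), hst, mul_assoc, mul_assoc]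
  fin_cases a <;>
  · simp [Fin.sum_univ_three, eps, mul_add, add_mul, key, hs.sq, hs.xy, hs.yx,
      hs.yz, hs.zy, hs.zx, hs.xz, ht.sq, ht.xy, ht.yx, ht.yz, ht.zy, ht.zx, ht.xz, smul_smul,
      smul_add, smul_sub]
    module

/-- For pairwise distinct sites `i, j, k` of an `N`-qubit system,
`i[H_{ij}, H_{ijk}] = 4(H_{ik} − H_{jk})`. -/
theorem comm_twoBody_threeBody (N i j k : ℕ)
    (hi : 1 ≤ i) (hj : 1 ≤ j) (hk : 1 ≤ k)
    (hiN : i ≤ N) (hjN : j ≤ N) (hkN : k ≤ N)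
    (hij : i ≠ j) (hjk : j ≠ k) (hik : i ≠ k) :
    Complex.I • (twoBody N i j * threeBody N i j k - threeBody N i j k * twoBody N i j)
      = (4 : ℂ) • (twoBody N i k - twoBody N j k) := by
  have hsi := isPauliTriple_pauliAt hi hiN
  have hsj := isPauliTriple_pauliAt hj hjN
  have hcross (a : Fin 3) := hsi.comm_dot_cross hsj (fun a b => pauliAt_comm hij.symm b a) a
  have hthree : threeBody N i j k = ∑ c, (∑ a, ∑ b, eps a b c • (pauliAt N i a * pauliAt N j b)) *
      pauliAt N k c := by
    simp only [threeBody, Finset.sum_mul, smul_mul_assoc]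
    rw [Finset.sum_comm_cycle]
  have hk_comm (c : Fin 3) : pauliAt N k c * twoBody N i j = twoBody N i j * pauliAt N k c := by
    simp only [twoBody, Finset.mul_sum, Finset.sum_mul]
    refine Finset.sum_congr rfl fun a _ => ?_
    rw [← mul_assoc, pauliAt_comm hik.symm, mul_assoc, pauliAt_comm hjk.symm, mul_assoc]
  rw [hthree, Finset.mul_sum, Finset.sum_mul, ← Finset.sum_sub_distrib, Finset.smul_sum,
    twoBody.eq_def N i k, twoBody.eq_def N j k, ← Finset.sum_sub_distrib, Finset.smul_sum]
  refine Finset.sum_congr rfl fun c _ => ?_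
  rw [mul_assoc _ (pauliAt N k c), hk_comm, ← mul_assoc, ← mul_assoc, ← sub_mul, ← sub_mul,
    ← smul_mul_assoc, ← smul_mul_assoc, ← hcross c, twoBody]
end

section
/- For an N-qubit system and pairwise distinct sites i, j, k, the iterated commutator identity i[ i[H_{ij}, H_{ijk}], H_{ijk} ] = 16(H_{ik} + H_{jk} − 2H_{ij}) holds, where H_{ij} = σ^(i)·σ^(j) and H_{ijk} = σ^(i)·(σ^(j)×σ^(k)). -/
/-- The tensor product of a family of single-site operators. -/
def siteTensor {N : ℕ} (M : Fin N → Matrix (Fin 2) (Fin 2) ℂ) :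
    Matrix (Fin N → Fin 2) (Fin N → Fin 2) ℂ :=
  Matrix.of fun f g => ∏ m, M m (f m) (g m)

lemma siteTensor_mul {N : ℕ} (M M' : Fin N → Matrix (Fin 2) (Fin 2) ℂ) :
    siteTensor M * siteTensor M' = siteTensor (M * M') := by
  ext f g
  simp only [siteTensor, Matrix.mul_apply, Matrix.of_apply, Pi.mul_apply, Fintype.prod_sum,
    Finset.prod_mul_distrib]

lemma siteTensor_one {N : ℕ} : siteTensor (1 : Fin N → Matrix (Fin 2) (Fin 2) ℂ) = 1 := by
  ext f g
  simp [siteTensor, Matrix.one_apply, Finset.prod_ite_zero, funext_iff]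

lemma siteTensor_mulSingle_smul {N : ℕ} (n : Fin N) (c : ℂ) (A : Matrix (Fin 2) (Fin 2) ℂ) :
    siteTensor (Pi.mulSingle n (c • A)) = c • siteTensor (Pi.mulSingle n A) := by
  ext f g
  simp only [siteTensor, Matrix.of_apply, Matrix.smul_apply, smul_eq_mul]
  rw [← Finset.mul_prod_erase _ _ (Finset.mem_univ n),
    ← Finset.mul_prod_erase _ _ (Finset.mem_univ n), ← mul_assoc]
  congr 1
  · simp
  · refine Finset.prod_congr rfl fun m hm => ?_
    simp [Pi.mulSingle_eq_of_ne (Finset.ne_of_mem_erase hm)]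

lemma pauliAt_eq_siteTensor {N : ℕ} (n : Fin N) (a : Fin 3) :
    pauliAt N (n + 1) a = siteTensor (Pi.mulSingle n (pauli a)) := by
  ext f g
  simp only [pauliAt, siteTensor, Matrix.of_apply]
  refine Finset.prod_congr rfl fun m _ => ?_
  by_cases h : m = n
  · subst h
    simp
  · have h' : (m : ℕ) ≠ n := fun e => h (Fin.ext e)
    simp [h, h', Matrix.one_apply]

/-- Three elements of a complex algebra multiplying like the Pauli matrices. -/
structure IsPauliTriple_s3 {R : Type*} [Ring R] [Algebra ℂ R] (p : Fin 3 → R) : Prop where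
  mul_self : ∀ a, p a * p a = 1
  mul_succ : ∀ a, p a * p (a + 1) = Complex.I • p (a + 2)
  succ_mul : ∀ a, p (a + 1) * p a = -(Complex.I • p (a + 2))

lemma isPauliTriple_pauli : IsPauliTriple_s3 pauli := by
  constructor <;> intro a <;> fin_cases a <;> ext r s <;> fin_cases r <;> fin_cases s <;>
    simp [pauli, Matrix.mul_apply, Fin.sum_univ_two]

lemma isPauliTriple_pauliAt_s3 {N : ℕ} (n : Fin N) : IsPauliTriple_s3 (pauliAt N (n + 1)) where
  mul_self a := by
    simp only [pauliAt_eq_siteTensor, siteTensor_mul, ← Pi.mulSingle_mul,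
      isPauliTriple_pauli.mul_self, Pi.mulSingle_one, siteTensor_one]
  mul_succ a := by
    simp only [pauliAt_eq_siteTensor, siteTensor_mul, ← Pi.mulSingle_mul,
      isPauliTriple_pauli.mul_succ, siteTensor_mulSingle_smul]
  succ_mul a := by
    simp only [pauliAt_eq_siteTensor, siteTensor_mul, ← Pi.mulSingle_mul,
      isPauliTriple_pauli.succ_mul, ← neg_smul, siteTensor_mulSingle_smul]

lemma pauliAt_commute {N : ℕ} {m n : Fin N} (h : m ≠ n) (a b : Fin 3) :
    Commute (pauliAt N (m + 1) a) (pauliAt N (n + 1) b) := by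
  simp only [pauliAt_eq_siteTensor, Commute, SemiconjBy, siteTensor_mul]
  rw [(Pi.mulSingle_commute h _ _).eq]

lemma swap_comm {R : Type*} [Ring R] {p q : Fin 3 → R}
    (hpq : ∀ a b, Commute (p a) (q b)) :
    1 + ∑ a, p a * q a = 1 + ∑ a, q a * p a := by
  simp only [(hpq _ _).eq]

section PauliTriple

variable {R : Type*} [Ring R] [Algebra ℂ R] {p q r : Fin 3 → R}

lemma IsPauliTriple_s3.table (hp : IsPauliTriple_s3 p) :
    (p 0 * p 1 = Complex.I • p 2 ∧ p 1 * p 2 = Complex.I • p 0 ∧ p 2 * p 0 = Complex.I • p 1) ∧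
    (p 1 * p 0 = -(Complex.I • p 2) ∧ p 2 * p 1 = -(Complex.I • p 0) ∧
      p 0 * p 2 = -(Complex.I • p 1)) :=
  ⟨⟨hp.mul_succ 0, hp.mul_succ 1, hp.mul_succ 2⟩, ⟨hp.succ_mul 0, hp.succ_mul 1, hp.succ_mul 2⟩⟩

/-- `1 + p · q` is twice the swap of the two sites. -/
lemma IsPauliTriple_s3.swap_mul (hp : IsPauliTriple_s3 p) (hq : IsPauliTriple_s3 q)
    (b : Fin 3) :
    (1 + ∑ a, p a * q a) * q b = p b * (1 + ∑ a, p a * q a) := by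
  obtain ⟨⟨p1, p2, p3⟩, p4, p5, p6⟩ := hp.table
  obtain ⟨⟨q1, q2, q3⟩, q4, q5, q6⟩ := hq.table
  simp only [Fin.sum_univ_three, add_mul, mul_add, one_mul, mul_one, mul_assoc]
  simp only [← mul_assoc (p _) (p _)]
  fin_cases b <;>
  simp [p1, p2, p3, p4, p5, p6, q1, q2, q3, q4, q5, q6, hp.mul_self, hq.mul_self] <;> abel

lemma IsPauliTriple_s3.swap_mul_self (hp : IsPauliTriple_s3 p) (hq : IsPauliTriple_s3 q)
    (hpq : ∀ a b, Commute (p a) (q b)) :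
    (1 + ∑ a, p a * q a) * (1 + ∑ a, p a * q a) = 4 := by
  obtain ⟨⟨p1, p2, p3⟩, p4, p5, p6⟩ := hp.table
  obtain ⟨⟨q1, q2, q3⟩, q4, q5, q6⟩ := hq.table
  have h (a b : Fin 3) : p a * q a * (p b * q b) = p a * p b * (q a * q b) :=
    (hpq b a).symm.mul_mul_mul_comm _ _
  simp only [Fin.sum_univ_three, add_mul, mul_add, one_mul, mul_one, h]
  simp [p1, p2, p3, p4, p5, p6, q1, q2, q3, q4, q5, q6, hp.mul_self, hq.mul_self, smul_smul]
  have : (4 : R) = 1 + 1 + 1 + 1 := by norm_num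
  rw [this]
  abel

/-- The swaps of three sites, each conjugating the other two into one another. -/
lemma IsPauliTriple_s3.swap_mul_swap (hp : IsPauliTriple_s3 p) (hq : IsPauliTriple_s3 q)
    (hpr : ∀ a b, Commute (p a) (r b))
    (hqr : ∀ a b, Commute (q a) (r b)) :
    (1 + ∑ a, p a * q a) * (1 + ∑ a, q a * r a) =
      (1 + ∑ a, p a * r a) * (1 + ∑ a, p a * q a) := by
  have h (b : Fin 3) : Commute (1 + ∑ a, p a * q a) (r b) :=
    (Commute.one_left _).add_left
      (Commute.sum_left _ _ _ fun a _ => (hpr a b).mul_left (hqr a b))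
  rw [mul_add, add_mul _ _ (1 + ∑ a, p a * q a), mul_one, one_mul, Finset.mul_sum, Finset.sum_mul]
  congr 1
  refine Finset.sum_congr rfl fun b _ => ?_
  rw [← mul_assoc, hp.swap_mul hq, mul_assoc, (h b).eq, mul_assoc]

/-- The scalar triple product is a commutator of swaps. -/
lemma IsPauliTriple_s3.triple_product_eq (hq : IsPauliTriple_s3 q)
    (hqr : ∀ a b, Commute (q a) (r b)) (hpq : ∀ a b, Commute (p a) (q b))
    (hpr : ∀ a b, Commute (p a) (r b)) :
    ∑ a, ∑ b, ∑ c, eps a b c • (p a * q b * r c) =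
      (Complex.I / 2) • ((1 + ∑ a, p a * q a) * (1 + ∑ a, q a * r a) -
        (1 + ∑ a, q a * r a) * (1 + ∑ a, p a * q a)) := by
  obtain ⟨⟨q1, q2, q3⟩, q4, q5, q6⟩ := hq.table
  have h1 (a b : Fin 3) : p a * q a * (q b * r b) = p a * (q a * q b) * r b := by
    simp only [mul_assoc]
  have h2 (a b : Fin 3) : q b * r b * (p a * q a) = p a * (q b * q a) * r b := by
    rw [mul_assoc, ← mul_assoc (r b), ← (hpr a b).eq, mul_assoc, ← (hqr a b).eq, ← mul_assoc,
      ← (hpq a b).eq]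
    simp only [mul_assoc]
  simp only [Fin.sum_univ_three, add_mul, mul_add, one_mul, mul_one, h1, h2]
  simp [eps, q1, q2, q3, q4, q5, q6, hq.mul_self]
  match_scalars <;> ring_nf <;> simp

end PauliTriple

/-- Swap relations for three sites force the iterated commutator identity. -/
lemma iterated_comm_of_swap {R : Type*} [Ring R] [Algebra ℂ R] {s t u : R}
    (hs : s * s = 4) (ht : t * t = 4) (hst : s * t = u * s) (hts : t * s = u * t)
    (hsu : s * u = t * s) (htu : t * u = s * t) (w : R)
    (hw : w = (Complex.I / 2) • (s * t - t * s)) :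
    Complex.I • ((Complex.I • ((s - 1) * w - w * (s - 1))) * w -
        w * (Complex.I • ((s - 1) * w - w * (s - 1)))) =
      (16 : ℂ) • ((u - 1) + (t - 1) - (2 : ℂ) • (s - 1)) := by
  have h4 (x : R) : 4 * x = (4 : ℂ) • x := by
    rw [Algebra.smul_def, map_ofNat]
  have h4' (x : R) : x * 4 = (4 : ℂ) • x := by
    rw [Algebra.smul_def, map_ofNat]; exact (Nat.cast_commute 4 x).symm.eq
  have hsst : s * (s * t) = (4 : ℂ) • t := by rw [← mul_assoc, hs, h4]
  have hsts : s * (t * s) = (4 : ℂ) • u := by rw [← hsu, ← mul_assoc, hs, h4]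
  have htts : t * (t * s) = (4 : ℂ) • s := by rw [← mul_assoc, ht, h4]
  have htst : t * (s * t) = (4 : ℂ) • u := by rw [← htu, ← mul_assoc, ht, h4]
  have hust : u * (s * t) = (4 : ℂ) • s := by rw [← mul_assoc, ← hst, mul_assoc, ht, h4']
  have huts : u * (t * s) = (4 : ℂ) • t := by rw [← mul_assoc, ← hts, mul_assoc, hs, h4']
  have hsts' : s * t * s = (4 : ℂ) • u := by rw [mul_assoc, hsts]
  have htst' : t * s * t = (4 : ℂ) • u := by rw [mul_assoc, htst]
  have htss : t * s * s = (4 : ℂ) • t := by rw [mul_assoc, hs, h4']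
  have hstt : s * t * t = (4 : ℂ) • s := by rw [mul_assoc, ht, h4']
  have hstu : s * t * u = (4 : ℂ) • t := by rw [mul_assoc, htu, hsst]
  have htsu : t * s * u = (4 : ℂ) • s := by rw [mul_assoc, hsu, htts]
  have hA : Complex.I • ((s - 1) * w - w * (s - 1)) = (4 : ℂ) • (u - t) := by
    rw [hw]
    simp only [sub_mul, mul_sub, one_mul, mul_one, smul_mul_assoc, mul_smul_comm,
      hsst, hsts, hsts', htss]
    match_scalars <;> ring_nf <;> simp
  rw [hA, hw]
  simp only [sub_mul, mul_sub, smul_mul_assoc, mul_smul_comm, hust, huts, htst, htts, hstu, htsu,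
    htst', hstt]
  match_scalars <;> ring_nf <;> simp

/-- For pairwise distinct sites `i, j, k` of an `N`-qubit system,
`i[ i[H_{ij}, H_{ijk}], H_{ijk} ] = 16(H_{ik} + H_{jk} − 2H_{ij})`. -/
theorem iterated_comm_twoBody_threeBody (N i j k : ℕ)
    (hi : 1 ≤ i) (hj : 1 ≤ j) (hk : 1 ≤ k)
    (hiN : i ≤ N) (hjN : j ≤ N) (hkN : k ≤ N)
    (hij : i ≠ j) (hjk : j ≠ k) (hik : i ≠ k) :
    Complex.I •
        ((Complex.I • (twoBody N i j * threeBody N i j k - threeBody N i j k * twoBody N i j))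
            * threeBody N i j k
          - threeBody N i j k *
            (Complex.I • (twoBody N i j * threeBody N i j k - threeBody N i j k * twoBody N i j)))
      = (16 : ℂ) • (twoBody N i k + twoBody N j k - (2 : ℂ) • twoBody N i j) := by
  obtain ⟨i', rfl⟩ : ∃ n : Fin N, i = n + 1 := ⟨⟨i - 1, by omega⟩, by simp; omega⟩
  obtain ⟨j', rfl⟩ : ∃ n : Fin N, j = n + 1 := ⟨⟨j - 1, by omega⟩, by simp; omega⟩
  obtain ⟨k', rfl⟩ : ∃ n : Fin N, k = n + 1 := ⟨⟨k - 1, by omega⟩, by simp; omega⟩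
  have hij' := pauliAt_commute (show i' ≠ j' by rintro rfl; exact hij rfl)
  have hjk' := pauliAt_commute (show j' ≠ k' by rintro rfl; exact hjk rfl)
  have hik' := pauliAt_commute (show i' ≠ k' by rintro rfl; exact hik rfl)
  have hp := isPauliTriple_pauliAt_s3 i'
  have hq := isPauliTriple_pauliAt_s3 j'
  have hr := isPauliTriple_pauliAt_s3 k'
  have hji' a b := (hij' b a).symm
  have hkj' a b := (hjk' b a).symm
  have hki' a b := (hik' b a).symm
  have hst := hp.swap_mul_swap hq hik' hjk'
  have hsu := hq.swap_mul_swap hp hjk' hik'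
  have hts := hr.swap_mul_swap hq hki' hji'
  have htu := hq.swap_mul_swap hr hji' hki'
  rw [← swap_comm hij'] at hsu
  rw [← swap_comm hjk', ← swap_comm hij', ← swap_comm hik'] at hts
  rw [← swap_comm hij', ← swap_comm hik'] at htu
  have key := iterated_comm_of_swap (hp.swap_mul_self hq hij') (hq.swap_mul_self hr hjk')
    hst hts hsu htu _ (hq.triple_product_eq hjk' hij' hik')
  simpa only [add_sub_cancel_left, twoBody, threeBody] using key
end

section
/- Define for each natural number N the real number S(N) = Σ_{K=0}^{⌊N/2⌋} ( ((N+1−2K)/(N+1)) · C(N+1, K) )², where C denotes the binomial coefficient (these summands are the squares of the dimensions d_{J,N} of the decoherence-free subspaces of N qubits under collective decoherence, with J = N/2 − K). Then √π · N^{3/2} · 4^{−N} · S(N) → 1 as N → ∞; that is, S(N) is asymptotically equivalent to 4^N / (√π · N^{3/2}). -/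
open Filter

/-- `S(N) = Σ_{K=0}^{⌊N/2⌋} ( ((N+1−2K)/(N+1)) · C(N+1,K) )²`, the sum of the squares of
the dimensions `d_{J,N}` of the decoherence-free subspaces of `N` qubits under collective
decoherence (with `J = N/2 − K`). -/
noncomputable def dfsDimSqSum (N : ℕ) : ℝ :=
  ∑ K ∈ Finset.range (N / 2 + 1),
    ((((N : ℝ) + 1 - 2 * K) / ((N : ℝ) + 1)) * (Nat.choose (N + 1) K : ℝ)) ^ 2

/-- A special case of Vandermonde's identity. -/
theorem sum_range_choose_mul_choose_succ (n : ℕ) :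
    ∑ j ∈ Finset.range (n + 1), n.choose j * n.choose (j + 1) = (2 * n).choose (n + 1) := by
  rw [two_mul, Nat.add_choose_eq, Finset.Nat.sum_antidiagonal_eq_sum_range_succ_mk,
    Finset.sum_range_succ' _ (n + 1)]
  simp only [Nat.sub_zero, Nat.choose_succ_self, mul_zero, add_zero]
  refine Finset.sum_congr rfl fun j hj => ?_
  have hj' : j ≤ n := Nat.lt_succ_iff.mp (Finset.mem_range.mp hj)
  rw [Nat.add_sub_add_right, Nat.choose_symm hj', mul_comm]

/-- A sum over `0, …, n + 1` of a function symmetric under `k ↦ n + 1 - k` and vanishing at the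
midpoint is twice the sum over its first half. -/
theorem sum_range_eq_two_mul_sum_half {R : Type*} [Semiring R] (n : ℕ) (f : ℕ → R)
    (hsymm : ∀ k ≤ n + 1, f (n + 1 - k) = f k) (hmid : ∀ k, 2 * k = n + 1 → f k = 0) :
    ∑ k ∈ Finset.range (n + 2), f k = 2 * ∑ k ∈ Finset.range (n / 2 + 1), f k := by
  have key : ∀ m a : ℕ, m + a = n + 2 →
      ∑ k ∈ Finset.range m, f (a + k) = ∑ k ∈ Finset.range m, f k := by
    intro m a h
    rw [← Finset.sum_range_reflect]
    refine Finset.sum_congr rfl fun k hk => ?_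
    have hk' := Finset.mem_range.mp hk
    rw [← hsymm k (by omega)]
    congr 1
    omega
  obtain ⟨m, hm | hm⟩ := Nat.even_or_odd' n
  · have h1 : n / 2 + 1 = m + 1 := by omega
    have h2 : n + 2 = (m + 1) + (m + 1) := by omega
    rw [h1, h2, Finset.sum_range_add, key _ _ (by omega), two_mul]
  · have h1 : n / 2 + 1 = m + 1 := by omega
    have h2 : n + 2 = (m + 1 + 1) + (m + 1) := by omega
    rw [h1, h2, Finset.sum_range_add, key _ _ (by omega),
      Finset.sum_range_succ _ (m + 1), hmid (m + 1) (by omega), add_zero, two_mul]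

/-- The second central moment of the squared binomial coefficients. -/
theorem sum_range_sub_mul_choose_sq (n : ℕ) :
    ∑ k ∈ Finset.range (n + 2), (((n : ℝ) + 1 - 2 * k) * ((n + 1).choose k : ℝ)) ^ 2 =
      2 * ((n : ℝ) + 1) * (n.centralBinom : ℝ) := by
  have hsq : ∑ k ∈ Finset.range (n + 2), ((n + 1).choose k : ℝ) ^ 2 =
      ((n + 1).centralBinom : ℝ) := by
    rw [Nat.centralBinom_eq_two_mul_choose, ← Nat.sum_range_choose_sq]
    push_cast
    rfl
  have hcross : ∑ k ∈ Finset.range (n + 2),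
      (k : ℝ) * ((n : ℝ) + 1 - k) * ((n + 1).choose k : ℝ) ^ 2 =
      ((n : ℝ) + 1) ^ 2 * ((2 * n).choose (n + 1) : ℝ) := by
    rw [Finset.sum_range_succ', ← sum_range_choose_mul_choose_succ]
    push_cast
    rw [Finset.mul_sum, zero_mul, zero_mul, add_zero]
    refine Finset.sum_congr rfl fun j hj => ?_
    have hj' : j ≤ n := Nat.lt_succ_iff.mp (Finset.mem_range.mp hj)
    have h1 : ((n : ℝ) + 1) * (n.choose j : ℝ) = ((n + 1).choose (j + 1) : ℝ) * (j + 1) := by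
      exact_mod_cast Nat.add_one_mul_choose_eq n j
    have h2 : (n.choose (j + 1) : ℝ) * (n + 1) =
        ((n + 1).choose (j + 1) : ℝ) * ((n : ℝ) + 1 - (j + 1)) := by
      have h := Nat.choose_mul_succ_eq n (j + 1)
      have h3 : ((n + 1 - (j + 1) : ℕ) : ℝ) = (n : ℝ) + 1 - (j + 1) := by
        rw [Nat.cast_sub (by omega)]
        push_cast
        ring
      rw [← h3]
      exact_mod_cast h
    linear_combination (-(n.choose (j + 1) : ℝ) * (n + 1)) * h1 -
      ((n + 1).choose (j + 1) : ℝ) * (j + 1) * h2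
  have hc : ((n : ℝ) + 1) * ((n + 1).centralBinom : ℝ) =
      2 * (2 * n + 1) * (n.centralBinom : ℝ) := by
    exact_mod_cast Nat.succ_mul_centralBinom_succ n
  have hd : ((2 * n).choose (n + 1) : ℝ) * (n + 1) = (n.centralBinom : ℝ) * n := by
    have h := Nat.choose_succ_right_eq (2 * n) n
    rw [two_mul, Nat.add_sub_cancel, ← two_mul, ← Nat.centralBinom_eq_two_mul_choose] at h
    exact_mod_cast h
  calc _ = ((n : ℝ) + 1) ^ 2 * ∑ k ∈ Finset.range (n + 2), ((n + 1).choose k : ℝ) ^ 2 -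
        4 * ∑ k ∈ Finset.range (n + 2),
          (k : ℝ) * ((n : ℝ) + 1 - k) * ((n + 1).choose k : ℝ) ^ 2 := by
        rw [Finset.mul_sum, Finset.mul_sum, ← Finset.sum_sub_distrib]
        exact Finset.sum_congr rfl fun k _ => by ring
    _ = _ := by
        rw [hsq, hcross]
        linear_combination ((n : ℝ) + 1) * hc - 4 * ((n : ℝ) + 1) * hd

/-- `S(N)` is the `N`-th Catalan number. -/
theorem dfsDimSqSum_eq (N : ℕ) :
    dfsDimSqSum N = (N.centralBinom : ℝ) / ((N : ℝ) + 1) := by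
  have hN : (N : ℝ) + 1 ≠ 0 := by positivity
  have h := sum_range_sub_mul_choose_sq N
  rw [sum_range_eq_two_mul_sum_half] at h
  · have hS : dfsDimSqSum N = (∑ k ∈ Finset.range (N / 2 + 1),
        (((N : ℝ) + 1 - 2 * k) * ((N + 1).choose k : ℝ)) ^ 2) / ((N : ℝ) + 1) ^ 2 := by
      rw [dfsDimSqSum, Finset.sum_div]
      exact Finset.sum_congr rfl fun k _ => by rw [div_mul_eq_mul_div, div_pow]
    rw [hS, div_eq_div_iff (pow_ne_zero 2 hN) hN]
    linear_combination ((N : ℝ) + 1) / 2 * h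
  · intro k hk
    rw [Nat.choose_symm hk, Nat.cast_sub hk]
    push_cast
    ring
  · intro k hk
    have hk' : 2 * (k : ℝ) = N + 1 := by exact_mod_cast hk
    rw [hk', sub_self, zero_mul, zero_pow two_ne_zero]

theorem stirlingSeq_two_mul_div_sq {n : ℕ} (hn : n ≠ 0) :
    Stirling.stirlingSeq (2 * n) / Stirling.stirlingSeq n ^ 2 =
      (n.centralBinom : ℝ) * Real.sqrt n / 4 ^ n := by
  have hn' : (0 : ℝ) < n := by positivity
  have hfac : ((2 * n).factorial : ℝ) = n.centralBinom * (n.factorial : ℝ) ^ 2 := by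
    have h := Nat.choose_mul_factorial_mul_factorial (n := 2 * n) (k := n) (by omega)
    rw [show 2 * n - n = n by omega, ← Nat.centralBinom_eq_two_mul_choose] at h
    rw [← h]
    push_cast
    ring
  have hs : Real.sqrt (2 * (2 * n : ℝ)) = 2 * Real.sqrt n := by
    rw [← mul_assoc, Real.sqrt_mul (by norm_num), show (2 * 2 : ℝ) = 2 ^ 2 by norm_num,
      Real.sqrt_sq (by norm_num)]
  have hs2 : Real.sqrt (2 * n : ℝ) ^ 2 = 2 * Real.sqrt n ^ 2 := by
    rw [Real.sq_sqrt (by positivity), Real.sq_sqrt hn'.le]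
  have hp : (2 * n / Real.exp 1 : ℝ) ^ (2 * n) = 4 ^ n * ((n / Real.exp 1 : ℝ) ^ n) ^ 2 := by
    rw [mul_div_assoc, mul_pow, pow_mul, pow_mul']
    norm_num
  have hq : (0 : ℝ) < (n / Real.exp 1 : ℝ) ^ n := by positivity
  have hr : 0 < Real.sqrt n := Real.sqrt_pos.mpr hn'
  have hf : (0 : ℝ) < n.factorial := by positivity
  rw [Stirling.stirlingSeq, Stirling.stirlingSeq]
  push_cast
  rw [hs, hfac, hp, div_pow _ (Real.sqrt _ * _), mul_pow (Real.sqrt _), hs2]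
  field_simp

/-- `C(2n, n) ~ 4^n / √(π n)`. -/
theorem tendsto_centralBinom_mul_sqrt_div_four_pow :
    Tendsto (fun n : ℕ => (n.centralBinom : ℝ) * Real.sqrt n / 4 ^ n) atTop
      (nhds (Real.sqrt Real.pi)⁻¹) := by
  have hpi : Real.sqrt Real.pi ≠ 0 := (Real.sqrt_pos.mpr Real.pi_pos).ne'
  have h2 : Tendsto (fun n : ℕ => 2 * n) atTop atTop :=
    tendsto_id.const_mul_atTop' two_pos
  have h := (Stirling.tendsto_stirlingSeq_sqrt_pi.comp h2).div
    (Stirling.tendsto_stirlingSeq_sqrt_pi.pow 2) (pow_ne_zero 2 hpi)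
  rw [sq, div_mul_cancel_left₀ hpi] at h
  refine h.congr' ?_
  filter_upwards [eventually_ne_atTop 0] with n hn
  exact stirlingSeq_two_mul_div_sq hn

/-- Asymptotically, `S(N) ~ 4^N / (√π · N^{3/2})`:
`√π · N^{3/2} · 4^{−N} · S(N) → 1` as `N → ∞`. -/
theorem dfsDimSqSum_asymptotic :
    Tendsto
      (fun N : ℕ =>
        Real.sqrt Real.pi * (N : ℝ) ^ ((3 : ℝ) / 2) * ((4 : ℝ) ^ N)⁻¹ * dfsDimSqSum N)
      atTop (nhds 1) := by
  have hpi : Real.sqrt Real.pi ≠ 0 := (Real.sqrt_pos.mpr Real.pi_pos).ne'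
  have h := (tendsto_centralBinom_mul_sqrt_div_four_pow.const_mul (Real.sqrt Real.pi)).mul
    (tendsto_natCast_div_add_atTop (1 : ℝ))
  rw [mul_inv_cancel₀ hpi, mul_one] at h
  refine h.congr' ?_
  filter_upwards [eventually_gt_atTop 0] with N hN
  have hN' : (0 : ℝ) < N := by exact_mod_cast hN
  have hpow : (N : ℝ) ^ ((3 : ℝ) / 2) = N * Real.sqrt N := by
    rw [show (3 : ℝ) / 2 = 1 + 1 / 2 by norm_num, Real.rpow_add hN', Real.rpow_one,
      Real.sqrt_eq_rpow]
  rw [dfsDimSqSum_eq, hpow]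
  ring
end

section
/- (Subsystem-fidelity lower bound.) Let A be a Hermitian (d₁d₂)×(d₁d₂) complex matrix (indexed by pairs from Fin d₁ × Fin d₂), let B be a Hermitian d₁×d₁ complex matrix with B·B = B and Tr B = 1, and let C be a Hermitian d₂×d₂ complex matrix. Then ‖A − B ⊗ C‖_HS² ≥ Re Tr( A·A·(𝟙 − B ⊗ 𝟙_{d₂}) ), where ⊗ is the Kronecker product, 𝟙 denotes identity matrices, and ‖X‖_HS² = Tr(X†X) is the squared Hilbert–Schmidt (Frobenius) norm. -/
open Matrix
open scoped Kronecker

/-- For an orthogonal projection `P`, `Tr(X†X P) = ‖X P‖²_HS`. -/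
theorem trace_conjTranspose_mul_self_mul_projection {n : Type*} [Fintype n]
    (X P : Matrix n n ℂ) (hP : P.IsHermitian) (hP2 : P * P = P) :
    (Xᴴ * X * P).trace = ((X * P)ᴴ * (X * P)).trace := by
  rw [conjTranspose_mul, hP.eq, Matrix.mul_assoc P, Matrix.trace_mul_comm P]
  simp only [Matrix.mul_assoc, hP2]

open scoped ComplexOrder in
/-- If the row space of `K` lies in the range of an orthogonal projection `P`, then
`‖A − K‖²_HS ≥ Tr(A†A (𝟙 − P))`. -/
theorem re_trace_mul_one_sub_projection_le {n : Type*} [Fintype n] [DecidableEq n]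
    (A K P : Matrix n n ℂ) (hP : P.IsHermitian) (hP2 : P * P = P) (hK : K * P = K) :
    ((Aᴴ * A * (1 - P)).trace).re ≤ (((A - K)ᴴ * (A - K)).trace).re := by
  have hQ : (1 - P).IsHermitian := isHermitian_one.sub hP
  have hQ2 : (1 - P) * (1 - P) = 1 - P := by
    simp [Matrix.mul_sub, Matrix.sub_mul, hP2]
  have hAQ : A * (1 - P) = (A - K) * (1 - P) := by
    simp [Matrix.mul_sub, Matrix.sub_mul, hK]
  have hsplit : ((A - K)ᴴ * (A - K)).trace =
      ((A - K)ᴴ * (A - K) * (1 - P)).trace + ((A - K)ᴴ * (A - K) * P).trace := by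
    rw [← trace_add, ← Matrix.mul_add, sub_add_cancel, Matrix.mul_one]
  have hnonneg : 0 ≤ (((A - K)ᴴ * (A - K) * P).trace).re := by
    rw [trace_conjTranspose_mul_self_mul_projection _ _ hP hP2]
    exact (Complex.nonneg_iff.mp (posSemidef_conjTranspose_mul_self _).trace_nonneg).1
  rw [hsplit, Complex.add_re, trace_conjTranspose_mul_self_mul_projection A _ hQ hQ2, hAQ,
    ← trace_conjTranspose_mul_self_mul_projection _ _ hQ hQ2]
  exact le_add_of_nonneg_right hnonneg

/-- **Subsystem-fidelity lower bound.** For a Hermitian matrix `A` on the bipartite space,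
a Hermitian idempotent `B` with unit trace on the first factor, and a Hermitian `C` on the
second factor,
`‖A − B ⊗ C‖²_HS ≥ Re Tr( A·A·(𝟙 − B ⊗ 𝟙) )`. -/
theorem subsystem_fidelity_lower_bound (d₁ d₂ : ℕ)
    (A : Matrix (Fin d₁ × Fin d₂) (Fin d₁ × Fin d₂) ℂ) (hA : A.IsHermitian)
    (B : Matrix (Fin d₁) (Fin d₁) ℂ) (hB : B.IsHermitian)
    (hB2 : B * B = B) (hBtr : B.trace = 1)
    (C : Matrix (Fin d₂) (Fin d₂) ℂ) (hC : C.IsHermitian) :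
    (((A - B ⊗ₖ C)ᴴ * (A - B ⊗ₖ C)).trace).re ≥
      ((A * A * (1 - B ⊗ₖ (1 : Matrix (Fin d₂) (Fin d₂) ℂ))).trace).re := by
  have h := re_trace_mul_one_sub_projection_le A (B ⊗ₖ C) (B ⊗ₖ (1 : Matrix (Fin d₂) (Fin d₂) ℂ))
    (by rw [IsHermitian, conjTranspose_kronecker, hB.eq, conjTranspose_one])
    (by rw [← mul_kronecker_mul, hB2, Matrix.mul_one])
    (by rw [← mul_kronecker_mul, hB2, Matrix.mul_one])
  rwa [hA.eq] at h
end
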